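/- arXiv:1503.07760 — 3 statements merged into one kernel-verified Lean document; each statement's English description precedes it below -/
import Mathlib

section
/- Let U be a set, let b : ℝⁿ × U → ℝⁿ and σ : ℝⁿ × U → ℝ^{n×d} be such that for every u ∈ U the maps x ↦ b(x,u) and x ↦ σ(x,u) are differentiable. Fix p > 0 and c ∈ ℝ, and assume that for all x, y ∈ ℝⁿ and all u ∈ U one has ⟨D_x b(x,u) y, y⟩ + p ‖D_x σ(x,u) y‖₂² ≤ c |y|². Then for all x, y ∈ ℝⁿ and all u ∈ U one has ⟨b(x,u) − b(y,u), x − y⟩ + p ‖σ(x,u) − σ(y,u)‖₂² ≤ c |x − y|². -/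
open scoped RealInnerProductSpace

/-- If the linearized joint monotonicity condition holds for the derivatives of the
coefficients `b` and `σ`, then the (global) joint monotonicity condition holds for the
coefficients themselves. -/
theorem stmt_0 (n d : ℕ) (U : Type*)
    (b : EuclideanSpace ℝ (Fin n) → U → EuclideanSpace ℝ (Fin n))
    (σ : EuclideanSpace ℝ (Fin n) → U → EuclideanSpace ℝ (Fin n × Fin d))
    (hb : ∀ u : U, Differentiable ℝ (fun x => b x u))
    (hσ : ∀ u : U, Differentiable ℝ (fun x => σ x u))
    (p : ℝ) (hp : 0 < p) (c : ℝ)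
    (hmono : ∀ (x y : EuclideanSpace ℝ (Fin n)) (u : U),
      ⟪fderiv ℝ (fun z => b z u) x y, y⟫
        + p * ‖fderiv ℝ (fun z => σ z u) x y‖ ^ 2 ≤ c * ‖y‖ ^ 2) :
    ∀ (x y : EuclideanSpace ℝ (Fin n)) (u : U),
      ⟪b x u - b y u, x - y⟫ + p * ‖σ x u - σ y u‖ ^ 2 ≤ c * ‖x - y‖ ^ 2 := by
  intro x y u
  set h := x - y with hh
  set v := σ x u - σ y u with hv
  have hγ : ∀ t : ℝ, HasDerivAt (fun t : ℝ => y + t • h) h t := fun t => by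
    simpa using ((hasDerivAt_id t).smul_const h).const_add y
  have hB : ∀ t : ℝ, HasDerivAt (fun t : ℝ => b (y + t • h) u)
      (fderiv ℝ (fun z => b z u) (y + t • h) h) t := fun t => by
    have h1 := ((hb u) (y + t • h)).hasFDerivAt
    exact HasFDerivAt.comp_hasDerivAt (l := fun z => b z u) t h1 (hγ t)
  have hS : ∀ t : ℝ, HasDerivAt (fun t : ℝ => σ (y + t • h) u)
      (fderiv ℝ (fun z => σ z u) (y + t • h) h) t := fun t => by
    have h1 := ((hσ u) (y + t • h)).hasFDerivAt
    exact HasFDerivAt.comp_hasDerivAt (l := fun z => σ z u) t h1 (hγ t)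
  have hφ : ∀ t : ℝ, HasDerivAt
      (fun t : ℝ => ⟪b (y + t • h) u, h⟫ + 2 * p * ⟪σ (y + t • h) u, v⟫)
      (⟪fderiv ℝ (fun z => b z u) (y + t • h) h, h⟫
        + 2 * p * ⟪fderiv ℝ (fun z => σ z u) (y + t • h) h, v⟫) t := fun t => by
    have h1 := (hB t).inner ℝ (hasDerivAt_const t h)
    have h2 := ((hS t).inner ℝ (hasDerivAt_const t v)).const_mul (2 * p)
    have h3 := h1.add h2
    simp only [inner_zero_right, zero_add] at h3
    exact h3
  obtain ⟨t, -, ht⟩ := exists_hasDerivAt_eq_slope _ _ (zero_lt_one' ℝ)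
    (fun t _ => (hφ t).continuousAt.continuousWithinAt) (fun t _ => hφ t)
  have e1 : y + (1 : ℝ) • h = x := by simp [hh]
  have e0 : y + (0 : ℝ) • h = y := by simp
  simp only [e1, e0, sub_zero, div_one] at ht
  have m := hmono (y + t • h) h u
  have q := norm_sub_sq_real (fderiv ℝ (fun z => σ z u) (y + t • h) h) v
  have q2 := mul_nonneg hp.le
    (sq_nonneg ‖fderiv ℝ (fun z => σ z u) (y + t • h) h - v‖)
  rw [q] at q2
  have r : ⟪σ x u, v⟫ - ⟪σ y u, v⟫ = ‖v‖ ^ 2 := by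
    rw [← inner_sub_left, ← hv, real_inner_self_eq_norm_sq]
  have r' : p * ⟪σ x u, v⟫ - p * ⟪σ y u, v⟫ = p * ‖v‖ ^ 2 := by rw [← r]; ring
  rw [inner_sub_left]
  linarith
end

section
/- Let U be a set, let b : ℝⁿ × U → ℝⁿ and σ : ℝⁿ × U → ℝ^{n×d} be such that for every u ∈ U the maps x ↦ b(x,u) and x ↦ σ(x,u) are differentiable. Fix p > 0 and c ∈ ℝ, and assume that for all x, y ∈ ℝⁿ and all u ∈ U one has ⟨b(x,u) − b(y,u), x − y⟩ + p ‖σ(x,u) − σ(y,u)‖₂² ≤ c |x − y|². Then for all x, y ∈ ℝⁿ and all u ∈ U one has ⟨D_x b(x,u) y, y⟩ + p ‖D_x σ(x,u) y‖₂² ≤ c |y|². -/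
open scoped RealInnerProductSpace

/-- If the (global) joint monotonicity condition holds for the coefficients `b` and `σ`,
then the linearized joint monotonicity condition holds for their derivatives. -/
theorem stmt_1 (n d : ℕ) (U : Type*)
    (b : EuclideanSpace ℝ (Fin n) → U → EuclideanSpace ℝ (Fin n))
    (σ : EuclideanSpace ℝ (Fin n) → U → EuclideanSpace ℝ (Fin n × Fin d))
    (hb : ∀ u : U, Differentiable ℝ (fun x => b x u))
    (hσ : ∀ u : U, Differentiable ℝ (fun x => σ x u))
    (p : ℝ) (hp : 0 < p) (c : ℝ)
    (hmono : ∀ (x y : EuclideanSpace ℝ (Fin n)) (u : U),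
      ⟪b x u - b y u, x - y⟫ + p * ‖σ x u - σ y u‖ ^ 2 ≤ c * ‖x - y‖ ^ 2) :
    ∀ (x y : EuclideanSpace ℝ (Fin n)) (u : U),
      ⟪fderiv ℝ (fun z => b z u) x y, y⟫
        + p * ‖fderiv ℝ (fun z => σ z u) x y‖ ^ 2 ≤ c * ‖y‖ ^ 2 := by
  intro x y u
  have h1 := ((hb u x).hasFDerivAt.hasLineDerivAt y).tendsto_slope_zero
  have h2 := ((hσ u x).hasFDerivAt.hasLineDerivAt y).tendsto_slope_zero
  have h3 := (h1.inner (tendsto_const_nhds (x := y))).add ((h2.norm.pow 2).const_mul p)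
  refine le_of_tendsto h3 ?_
  filter_upwards [self_mem_nhdsWithin] with t ht
  have ht0 : t ≠ 0 := ht
  have h := hmono (x + t • y) x u
  have hpos : 0 < t ^ 2 := by positivity
  rw [add_sub_cancel_left, inner_smul_right, norm_smul, mul_pow, Real.norm_eq_abs, sq_abs] at h
  rw [inner_smul_left, norm_smul, mul_pow, norm_inv, Real.norm_eq_abs, inv_pow, sq_abs]
  simp only [conj_trivial]
  refine le_of_mul_le_mul_left ?_ hpos
  refine le_trans (le_of_eq ?_) (h.trans (le_of_eq ?_))
  · field_simp
  · ring
end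

section
/- Let m ≥ 1 be an integer, let a₁, …, a_{2m} ∈ ℝ and b₁, …, b_m ∈ ℝ, and define b(x) = −x^{2m+1} + Σ_{i=1}^{2m} aᵢ xⁱ and σ(x) = Σ_{i=1}^{m} bᵢ xⁱ for x ∈ ℝ. Then for every p > 0 there exists a constant c_p ∈ ℝ such that for all x, y ∈ ℝ one has (b(x) − b(y))(x − y) + p (σ(x) − σ(y))² ≤ c_p (x − y)². -/
lemma sum_diff_bound (n : ℕ) (a : ℕ → ℝ) : ∃ A : ℝ, 0 ≤ A ∧ ∀ x y S : ℝ, 1 ≤ S → |x| ≤ S → |y| ≤ S →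
    |(∑ i ∈ Finset.Icc 1 (n+1), a i * x ^ i) - ∑ i ∈ Finset.Icc 1 (n+1), a i * y ^ i|
      ≤ A * S ^ n * |x - y| := by
  refine ⟨∑ i ∈ Finset.Icc 1 (n+1), |a i| * i, Finset.sum_nonneg fun i _ => by positivity, ?_⟩
  intro x y S hS hx hy
  rw [← Finset.sum_sub_distrib, Finset.sum_mul, Finset.sum_mul]
  refine (Finset.abs_sum_le_sum_abs _ _).trans (Finset.sum_le_sum fun i hi => ?_)
  rw [Finset.mem_Icc] at hi
  rw [← mul_sub, abs_mul]
  have h1 := abs_pow_sub_pow_le x y i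
  have h2 : (max |x| |y|) ^ (i-1) ≤ S ^ n :=
    (pow_le_pow_left₀ (by positivity) (max_le hx hy) _).trans (pow_le_pow_right₀ hS (by omega))
  calc |a i| * |x ^ i - y ^ i| ≤ |a i| * (|x - y| * i * S ^ n) := by
        gcongr
        exact h1.trans (by gcongr)
    _ = _ := by ring

lemma lead_bound (m : ℕ) (x y : ℝ) :
    1 / 2 * (x ^ (2*m) + y ^ (2*m)) * (x - y) ^ 2 ≤ (x ^ (2*m+1) - y ^ (2*m+1)) * (x - y) := by
  have h : 0 ≤ (x ^ (2*m) - y ^ (2*m)) * (x ^ 2 - y ^ 2) := by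
    rw [pow_mul, pow_mul]
    rcases le_total (x^2) (y^2) with h | h
    · exact mul_nonneg_of_nonpos_of_nonpos
        (sub_nonpos.2 (pow_le_pow_left₀ (sq_nonneg _) h _)) (sub_nonpos.2 h)
    · exact mul_nonneg (sub_nonneg.2 (pow_le_pow_left₀ (sq_nonneg _) h _)) (sub_nonneg.2 h)
  rw [pow_succ x (2*m), pow_succ y (2*m)]
  nlinarith [h]


/-- Polynomial model: for `b(x) = −x^{2m+1} + Σ_{i=1}^{2m} aᵢ xⁱ` and
`σ(x) = Σ_{i=1}^{m} bᵢ xⁱ`, for every `p > 0` there is a constant `c_p` such that the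
joint monotonicity condition holds. -/
theorem stmt_12 (m : ℕ) (hm : 1 ≤ m) (a bcoeff : ℕ → ℝ) :
    ∀ p : ℝ, 0 < p → ∃ c : ℝ, ∀ x y : ℝ,
      ((-x ^ (2 * m + 1) + ∑ i ∈ Finset.Icc 1 (2 * m), a i * x ^ i)
          - (-y ^ (2 * m + 1) + ∑ i ∈ Finset.Icc 1 (2 * m), a i * y ^ i)) * (x - y)
        + p * ((∑ i ∈ Finset.Icc 1 m, bcoeff i * x ^ i)
            - (∑ i ∈ Finset.Icc 1 m, bcoeff i * y ^ i)) ^ 2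
      ≤ c * (x - y) ^ 2 := by
  intro p hp
  obtain ⟨n, rfl⟩ : ∃ n, m = n + 1 := ⟨m - 1, by omega⟩
  obtain ⟨A, hA0, hA⟩ := sum_diff_bound (2*n+1) a
  obtain ⟨B, hB0, hB⟩ := sum_diff_bound n bcoeff
  have e : 2 * (n + 1) = 2 * n + 1 + 1 := by ring
  obtain ⟨K, hK⟩ : ∃ K, K = A + p * B ^ 2 := ⟨_, rfl⟩
  have hK0 : 0 ≤ K := by rw [hK]; positivity
  refine ⟨1 / 2 + K * (2 * K) ^ (2*n+1), fun x y => ?_⟩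
  obtain ⟨S, hSd⟩ : ∃ S, S = max 1 (max |x| |y|) := ⟨_, rfl⟩
  have hS : 1 ≤ S := by rw [hSd]; exact le_max_left _ _
  have hx : |x| ≤ S := by rw [hSd]; exact (le_max_left _ _).trans (le_max_right _ _)
  have hy : |y| ≤ S := by rw [hSd]; exact (le_max_right _ _).trans (le_max_right _ _)
  have h1 := hA x y S hS hx hy
  have h2 := hB x y S hS hx hy
  have h3 := lead_bound (n+1) x y
  have hev : Even (2 * (n+1)) := even_two_mul _
  have h4 : S ^ (2*(n+1)) ≤ 1 + (x ^ (2*(n+1)) + y ^ (2*(n+1))) := by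
    have hxp := hev.pow_nonneg x
    have hyp := hev.pow_nonneg y
    rcases max_choice 1 (max |x| |y|) with h | h
    · rw [hSd, h, one_pow]; linarith
    · rcases max_choice |x| |y| with h' | h'
      · rw [hSd, h, h', hev.pow_abs]; linarith
      · rw [hSd, h, h', hev.pow_abs]; linarith
  rw [← e] at h1
  generalize (∑ i ∈ Finset.Icc 1 (2 * (n+1)), a i * x ^ i) = fx at *
  generalize (∑ i ∈ Finset.Icc 1 (2 * (n+1)), a i * y ^ i) = fy at *
  generalize (∑ i ∈ Finset.Icc 1 (n+1), bcoeff i * x ^ i) = gx at *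
  generalize (∑ i ∈ Finset.Icc 1 (n+1), bcoeff i * y ^ i) = gy at *
  have h5 : (fx - fy) * (x - y) ≤ A * S ^ (2*n+1) * (x - y) ^ 2 := by
    calc (fx - fy) * (x - y) ≤ |fx - fy| * |x - y| := by rw [← abs_mul]; exact le_abs_self _
      _ ≤ A * S ^ (2*n+1) * |x - y| * |x - y| := by gcongr
      _ = A * S ^ (2*n+1) * |x - y| ^ 2 := by ring
      _ = _ := by rw [sq_abs]
  have h6 : (gx - gy) ^ 2 ≤ B ^ 2 * S ^ (2*n+1) * (x - y) ^ 2 := by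
    calc (gx - gy) ^ 2 = |gx - gy| ^ 2 := (sq_abs _).symm
      _ ≤ (B * S ^ n * |x - y|) ^ 2 := by gcongr
      _ = B ^ 2 * S ^ (2*n) * |x - y| ^ 2 := by ring
      _ = B ^ 2 * S ^ (2*n) * (x - y) ^ 2 := by rw [sq_abs]
      _ ≤ _ := by gcongr <;> omega
  have h7 : K * S ^ (2*n+1) - 1 / 2 * S ^ (2*(n+1)) ≤ K * (2 * K) ^ (2*n+1) := by
    rw [e, pow_succ S (2*n+1)]
    have hp0 : 0 ≤ S ^ (2*n+1) := by positivity
    rcases le_total S (2 * K) with h | h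
    · have : K * S ^ (2*n+1) ≤ K * (2 * K) ^ (2*n+1) := by gcongr
      have : 0 ≤ S ^ (2*n+1) * S := by positivity
      linarith
    · have : 0 ≤ K * (2 * K) ^ (2*n+1) := by positivity
      nlinarith [mul_le_mul_of_nonneg_left h hp0]
  have h8 := mul_le_mul_of_nonneg_left h6 hp.le
  have h9 := mul_le_mul_of_nonneg_right h4 (sq_nonneg (x - y))
  have h10 := mul_le_mul_of_nonneg_right h7 (sq_nonneg (x - y))
  rw [hK] at h10 ⊢
  linarith
end
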